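/- arXiv:2305.00654 — 4 statements merged into one kernel-verified Lean document; each statement's English description precedes it below -/
import Mathlib

section
/- Let S be a finite nonempty type, let P : Matrix S S ℝ be row-stochastic, and let γ ∈ [0,1). Then the matrix 1 - γ • P is invertible and the Neumann series converges to its inverse: HasSum (fun t : ℕ => γ^t • P^t) ((1 - γ • P)⁻¹); equivalently, (1 - γ • P) ⬝ (∑' t, γ^t • P^t) = 1. -/
section

attribute [local instance] Matrix.linftyOpNormedRing Matrix.linftyOpNormedAlgebra

theorem Matrix.linfty_opNorm_le_one_of_rowStochastic {S : Type*} [Fintype S] [DecidableEq S]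
    {P : Matrix S S ℝ} (hP0 : ∀ i j, 0 ≤ P i j) (hP1 : ∀ i, ∑ j, P i j = 1) : ‖P‖ ≤ 1 := by
  rw [← coe_nnnorm, ← NNReal.coe_one, NNReal.coe_le_coe, Matrix.linfty_opNNNorm_def]
  refine Finset.sup_le fun i _ => ?_
  rw [← NNReal.coe_le_coe, NNReal.coe_sum, NNReal.coe_one, ← hP1 i]
  exact Finset.sum_le_sum fun j _ => by rw [coe_nnnorm, Real.norm_of_nonneg (hP0 i j)]

theorem Matrix.linfty_opNorm_smul_lt_one_of_rowStochastic {S : Type*} [Fintype S] [DecidableEq S]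
    {P : Matrix S S ℝ} (hP0 : ∀ i j, 0 ≤ P i j) (hP1 : ∀ i, ∑ j, P i j = 1)
    {γ : ℝ} (hγ0 : 0 ≤ γ) (hγ1 : γ < 1) : ‖γ • P‖ < 1 := by
  rw [norm_smul, Real.norm_of_nonneg hγ0]
  exact (mul_le_of_le_one_right hγ0
    (Matrix.linfty_opNorm_le_one_of_rowStochastic hP0 hP1)).trans_lt hγ1

theorem Matrix.hasSum_geometric_inv_of_rowStochastic {S : Type*} [Fintype S] [DecidableEq S]
    {P : Matrix S S ℝ} (hP0 : ∀ i j, 0 ≤ P i j) (hP1 : ∀ i, ∑ j, P i j = 1)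
    {γ : ℝ} (hγ0 : 0 ≤ γ) (hγ1 : γ < 1) :
    IsUnit (1 - γ • P) ∧ HasSum (fun t : ℕ => γ ^ t • P ^ t) (1 - γ • P)⁻¹ := by
  have h := Matrix.linfty_opNorm_smul_lt_one_of_rowStochastic hP0 hP1 hγ0 hγ1
  have : CompleteSpace (Matrix S S ℝ) := FiniteDimensional.complete ℝ _
  refine ⟨isUnit_one_sub_of_norm_lt_one h, ?_⟩
  simp only [← smul_pow, Matrix.nonsing_inv_eq_ringInverse]
  exact hasSum_geom_series_inverse _ h

end


/-- Neumann series for a row-stochastic matrix: for `γ ∈ [0,1)`, `1 - γ • P` is invertible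
and `∑ₜ γ^t • P^t` converges to its inverse; equivalently `(1 - γ•P) * ∑' t, γ^t • P^t = 1`. -/
theorem stmt_2 {S : Type*} [Fintype S] [Nonempty S] [DecidableEq S]
    (P : Matrix S S ℝ)
    (hP0 : ∀ i j, 0 ≤ P i j) (hP1 : ∀ i, ∑ j, P i j = 1)
    (γ : ℝ) (hγ0 : 0 ≤ γ) (hγ1 : γ < 1) :
    IsUnit (1 - γ • P) ∧
      HasSum (fun t : ℕ => γ ^ t • P ^ t) (1 - γ • P)⁻¹ ∧
      (1 - γ • P) * (∑' t : ℕ, γ ^ t • P ^ t) = 1 := by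
  obtain ⟨hu, hs⟩ := Matrix.hasSum_geometric_inv_of_rowStochastic hP0 hP1 hγ0 hγ1
  refine ⟨hu, hs, ?_⟩
  rw [hs.tsum_eq, Matrix.mul_nonsing_inv _ ((Matrix.isUnit_iff_isUnit_det _).1 hu)]
end

section
/- Let S be a finite nonempty type, let d : S → ℝ satisfy d s ≠ 0 for all s, let D = Matrix.diagonal d, and let P : Matrix S S ℝ be such that P ⬝ Pᵀ is invertible. Suppose U, V, Σ : Matrix S S ℝ satisfy Uᵀ ⬝ U = 1, Vᵀ ⬝ V = 1, Σ is diagonal with all diagonal entries nonzero, and D ⬝ P = U ⬝ Σ ⬝ Vᵀ. Then for every state s, the weighted squared norm of the s-th row of U satisfies (e_s)ᵀ ⬝ U ⬝ Σ⁻² ⬝ Uᵀ ⬝ e_s = α_s / (d s)², where α_s = ((P ⬝ Pᵀ)⁻¹)_{s,s} and Σ⁻² denotes the inverse of Σ ⬝ Σ. -/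
open Matrix

/-- Given an SVD `D * P = U * Σ * Vᵀ` of the weighted transition matrix (with
`D = diagonal d`, `d s ≠ 0`, `P * Pᵀ` invertible, `Σ` diagonal with nonzero diagonal
entries), the weighted squared norm of the `s`-th row of `U` satisfies
`eₛᵀ U Σ⁻² Uᵀ eₛ = α_s / (d s)²` where `α_s = ((P * Pᵀ)⁻¹)_{s,s}`. -/
theorem stmt_7 {S : Type*} [Fintype S] [Nonempty S] [DecidableEq S]
    (d : S → ℝ) (hd : ∀ s, d s ≠ 0)
    (P : Matrix S S ℝ) (hPPt : IsUnit (P * Pᵀ))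
    (U V Sg : Matrix S S ℝ)
    (hU : Uᵀ * U = 1) (hV : Vᵀ * V = 1)
    (σ : S → ℝ) (hσ : ∀ s, σ s ≠ 0) (hSg : Sg = Matrix.diagonal σ)
    (hSVD : Matrix.diagonal d * P = U * Sg * Vᵀ) :
    ∀ s : S,
      (Pi.single s 1 : S → ℝ) ⬝ᵥ (U * (Sg * Sg)⁻¹ * Uᵀ).mulVec (Pi.single s 1)
        = ((P * Pᵀ)⁻¹ s s) / (d s) ^ 2 := by
  intro s
  have hUinv : U⁻¹ = Uᵀ := Matrix.inv_eq_left_inv hU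
  have hUtinv : Uᵀ⁻¹ = U := Matrix.inv_eq_right_inv hU
  have hD : IsUnit (Matrix.diagonal d).det := by
    rw [Matrix.det_diagonal]
    exact (Finset.prod_ne_zero_iff.mpr fun i _ => hd i).isUnit
  have hGram : Matrix.diagonal d * (P * Pᵀ) * Matrix.diagonal d = U * (Sg * Sg) * Uᵀ := by
    calc Matrix.diagonal d * (P * Pᵀ) * Matrix.diagonal d
        = (Matrix.diagonal d * P) * (Matrix.diagonal d * P)ᵀ := by
          simp only [Matrix.transpose_mul, Matrix.diagonal_transpose, Matrix.mul_assoc]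
      _ = U * Sg * (Vᵀ * V) * Sg * Uᵀ := by
          rw [hSVD, hSg]
          simp only [Matrix.transpose_mul, Matrix.diagonal_transpose, Matrix.transpose_transpose,
            Matrix.mul_assoc]
      _ = U * (Sg * Sg) * Uᵀ := by
          rw [hV, Matrix.mul_one, Matrix.mul_assoc U Sg Sg]
  have hGramInv : (P * Pᵀ)⁻¹ =
      Matrix.diagonal d * (U * (Sg * Sg)⁻¹ * Uᵀ) * Matrix.diagonal d := by
    have hInv : (U * (Sg * Sg) * Uᵀ)⁻¹ = U * (Sg * Sg)⁻¹ * Uᵀ := by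
      rw [Matrix.mul_inv_rev, Matrix.mul_inv_rev U, hUinv, hUtinv, Matrix.mul_assoc]
    rw [← hInv, ← hGram, Matrix.mul_inv_rev _ (Matrix.diagonal d),
      Matrix.mul_inv_rev (Matrix.diagonal d),
      Matrix.mul_nonsing_inv_cancel_left _ _ hD, Matrix.nonsing_inv_mul_cancel_right _ _ hD]
  rw [hGramInv, Matrix.mul_diagonal, Matrix.diagonal_mul, Matrix.mulVec_single_one,
    single_one_dotProduct, Matrix.col_apply]
  field_simp [hd s]
end

section
/- Fix n ≥ 1, k ≥ 2, a real normed space Θ, batch sizes b, b₂ ≥ 1, and for each i ∈ Fin n maps u_i, v_i : Θ → ℝ^k differentiable at θ₀ ∈ Θ. Define Σ(θ) = (1/n) ∑_i u_i(θ) v_i(θ)ᵀ, and for batches B₁ : Fin b → Fin n and B₂ : Fin b₂ → Fin n the minibatch matrices Σ̂_{B₁}(θ) = (1/b) ∑_j u_{B₁ j}(θ) v_{B₁ j}(θ)ᵀ and Σ̂̂_{B₂}(θ) = (1/b₂) ∑_j u_{B₂ j}(θ) v_{B₂ j}(θ)ᵀ. For each pair (B₁, B₂) define the double-sampled stop-gradient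 derivative G(B₁,B₂) := (1/(k²−k)) ∑_{i≠j} [ (fderiv ℝ (fun θ => Σ̂_{B₁}(θ)_{ij}) θ₀) · Σ̂̂_{B₂}(θ₀)_{ij} + Σ̂_{B₁}(θ₀)_{ij} · (fderiv ℝ (fun θ => Σ̂̂_{B₂}(θ)_{ij}) θ₀) ]. Then the uniform average of G over all n^b · n^{b₂} pairs of independent batches equals the Fréchet derivative at θ₀ of θ ↦ L_off(Σ(θ)) = (1/(k²−k)) ∑_{i≠j} Σ(θ)_{ij}²; i.e., the double-sampled stop-gradient estimator of the off-diagonal loss gradient is unbiased. -/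
/-- The sum over all batches of a single sampled entry. -/
theorem sum_batch_apply {M : Type*} [AddCommGroup M] [Module ℝ M] {n b : ℕ}
    (f : Fin n → M) (j : Fin b) :
    ∑ B : Fin b → Fin n, f (B j) = (n : ℝ) ^ (b - 1) • ∑ l, f l := by
  rw [← (Equiv.funSplitAt j (Fin n)).symm.sum_comp, Fintype.sum_prod_type, Finset.smul_sum]
  refine Finset.sum_congr rfl fun l _ => ?_
  simp [Equiv.funSplitAt, Equiv.piSplitAt, Fintype.card_subtype_compl, ← Nat.cast_smul_eq_nsmul ℝ]

/-- The minibatch mean with replacement is unbiased. -/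
theorem sum_batch_mean {M : Type*} [AddCommGroup M] [Module ℝ M] {n b : ℕ}
    (hn : 1 ≤ n) (hb : 1 ≤ b) (f : Fin n → M) :
    ∑ B : Fin b → Fin n, (1 / (b : ℝ)) • ∑ j, f (B j) =
      (n : ℝ) ^ b • (1 / (n : ℝ)) • ∑ l, f l := by
  have hn' : (n : ℝ) ≠ 0 := by positivity
  have hb' : (b : ℝ) ≠ 0 := by positivity
  rw [← Finset.smul_sum, Finset.sum_comm]
  simp only [sum_batch_apply, Finset.sum_const, Finset.card_univ, Fintype.card_fin,
    ← Nat.cast_smul_eq_nsmul ℝ, smul_smul]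
  congr 1
  obtain ⟨c, rfl⟩ := Nat.exists_eq_add_of_le' hb
  rw [Nat.add_sub_cancel, pow_succ]
  field_simp

/-- Averaging the product rule over two independent batches gives the derivative of a square. -/
theorem sum_batch_pair {M : Type*} [AddCommGroup M] [Module ℝ M] {n b b₂ : ℕ}
    (hn : 1 ≤ n) (hb : 1 ≤ b) (hb₂ : 1 ≤ b₂) (w : Fin n → ℝ) (D : Fin n → M) :
    ∑ B₁ : Fin b → Fin n, ∑ B₂ : Fin b₂ → Fin n,
      (((1 / (b₂ : ℝ)) * ∑ j, w (B₂ j)) • (1 / (b : ℝ)) • ∑ j, D (B₁ j) +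
        ((1 / (b : ℝ)) * ∑ j, w (B₁ j)) • (1 / (b₂ : ℝ)) • ∑ j, D (B₂ j)) =
      ((n : ℝ) ^ b * (n : ℝ) ^ b₂) •
        (2 * ((1 / (n : ℝ)) * ∑ l, w l)) • (1 / (n : ℝ)) • ∑ l, D l := by
  have hw {c : ℕ} (hc : 1 ≤ c) :
      ∑ B : Fin c → Fin n, (1 / (c : ℝ)) * ∑ j, w (B j) =
        (n : ℝ) ^ c * ((1 / (n : ℝ)) * ∑ l, w l) := by
    simpa only [smul_eq_mul] using sum_batch_mean hn hc w
  simp only [Finset.sum_add_distrib]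
  rw [Finset.sum_comm, ← Finset.sum_smul_sum, ← Finset.sum_smul_sum, hw hb, hw hb₂,
    sum_batch_mean hn hb D, sum_batch_mean hn hb₂ D]
  module

/-- The derivative of a scaled finite sum. -/
theorem hasFDerivAt_mean {ι Θ : Type*} [Fintype ι] [NormedAddCommGroup Θ] [NormedSpace ℝ Θ]
    {f : ι → Θ → ℝ} {θ₀ : Θ} (hf : ∀ i, DifferentiableAt ℝ (f i) θ₀) (c : ℝ) :
    HasFDerivAt (fun θ => c * ∑ i, f i θ) (c • ∑ i, fderiv ℝ (f i) θ₀) θ₀ :=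
  (HasFDerivAt.fun_sum fun i _ => (hf i).hasFDerivAt).const_mul c


/-- The double-sampled stop-gradient estimator of the gradient of the off-diagonal loss
`L_off(Σ(θ)) = (1/(k²−k)) ∑_{p≠q} Σ(θ)_{pq}²` is unbiased: the uniform average over all
pairs of independent batches `(B₁, B₂)` of
`G(B₁,B₂) = (1/(k²−k)) ∑_{p≠q} [ (∂ Σ̂_{B₁,pq}) ⬝ sg(Σ̂̂_{B₂,pq}) + sg(Σ̂_{B₁,pq}) ⬝ (∂ Σ̂̂_{B₂,pq}) ]`
equals `fderiv ℝ (fun θ => L_off (Σ θ)) θ₀`. -/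
theorem stmt_14 (n k b b₂ : ℕ) (hn : 1 ≤ n) (hk : 2 ≤ k) (hb : 1 ≤ b) (hb₂ : 1 ≤ b₂)
    {Θ : Type*} [NormedAddCommGroup Θ] [NormedSpace ℝ Θ]
    (u v : Fin n → Θ → Fin k → ℝ) (θ₀ : Θ)
    (hu : ∀ i, DifferentiableAt ℝ (u i) θ₀)
    (hv : ∀ i, DifferentiableAt ℝ (v i) θ₀) :
    (1 / ((n : ℝ) ^ b * (n : ℝ) ^ b₂)) •
      ∑ B₁ : Fin b → Fin n, ∑ B₂ : Fin b₂ → Fin n,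
        ((1 / ((k : ℝ) ^ 2 - k)) •
          ∑ p : Fin k, ∑ q : Fin k,
            (if p = q then (0 : Θ →L[ℝ] ℝ) else
              ((1 / (b₂ : ℝ)) * ∑ j : Fin b₂, u (B₂ j) θ₀ p * v (B₂ j) θ₀ q) •
                fderiv ℝ (fun θ : Θ =>
                  (1 / (b : ℝ)) * ∑ j : Fin b, u (B₁ j) θ p * v (B₁ j) θ q) θ₀
              + ((1 / (b : ℝ)) * ∑ j : Fin b, u (B₁ j) θ₀ p * v (B₁ j) θ₀ q) •
                fderiv ℝ (fun θ : Θ =>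
                  (1 / (b₂ : ℝ)) * ∑ j : Fin b₂, u (B₂ j) θ p * v (B₂ j) θ q) θ₀))
      = fderiv ℝ (fun θ : Θ =>
          (1 / ((k : ℝ) ^ 2 - k)) * ∑ p : Fin k, ∑ q : Fin k,
            (if p = q then 0 else
              ((1 / (n : ℝ)) * ∑ l : Fin n, u l θ p * v l θ q) ^ 2)) θ₀ := by
  have hn' : (n : ℝ) ≠ 0 := by positivity
  have hw (p q : Fin k) (l : Fin n) : DifferentiableAt ℝ (fun θ => u l θ p * v l θ q) θ₀ :=
    (differentiableAt_pi.1 (hu l) p).mul (differentiableAt_pi.1 (hv l) q)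
  have hbatch {c : ℕ} (B : Fin c → Fin n) (p q : Fin k) :
      fderiv ℝ (fun θ => (1 / (c : ℝ)) * ∑ j, u (B j) θ p * v (B j) θ q) θ₀ =
        (1 / (c : ℝ)) • ∑ j, fderiv ℝ (fun θ => u (B j) θ p * v (B j) θ q) θ₀ :=
    (hasFDerivAt_mean (fun j => hw p q (B j)) _).fderiv
  have hloss : HasFDerivAt (fun θ : Θ =>
      (1 / ((k : ℝ) ^ 2 - k)) * ∑ p : Fin k, ∑ q : Fin k,
        (if p = q then 0 else ((1 / (n : ℝ)) * ∑ l : Fin n, u l θ p * v l θ q) ^ 2))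
      ((1 / ((k : ℝ) ^ 2 - k)) • ∑ p : Fin k, ∑ q : Fin k,
        (if p = q then (0 : Θ →L[ℝ] ℝ) else
          (2 * ((1 / (n : ℝ)) * ∑ l, u l θ₀ p * v l θ₀ q)) •
            (1 / (n : ℝ)) • ∑ l, fderiv ℝ (fun θ => u l θ p * v l θ q) θ₀)) θ₀ := by
    refine (HasFDerivAt.fun_sum fun p _ => HasFDerivAt.fun_sum fun q _ => ?_).const_mul _
    split_ifs
    · exact hasFDerivAt_const _ _
    · simpa using (hasFDerivAt_mean (hw p q) (1 / (n : ℝ))).pow 2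
  rw [hloss.fderiv]
  simp only [hbatch, ← Finset.smul_sum]
  rw [smul_comm]
  congr 1
  simp only [Finset.sum_comm (s := (Finset.univ : Finset (Fin b₂ → Fin n)))
      (t := (Finset.univ : Finset (Fin k))),
    Finset.sum_comm (s := (Finset.univ : Finset (Fin b → Fin n)))
      (t := (Finset.univ : Finset (Fin k)))]
  rw [Finset.smul_sum]
  refine Finset.sum_congr rfl fun p _ => ?_
  rw [Finset.smul_sum]
  refine Finset.sum_congr rfl fun q _ => ?_
  split_ifs with h
  · simp
  · rw [sum_batch_pair hn hb hb₂ (fun l => u l θ₀ p * v l θ₀ q)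
      (fun l => fderiv ℝ (fun θ => u l θ p * v l θ q) θ₀), smul_smul, one_div,
      inv_mul_cancel₀ (by positivity), one_smul]
end

section
/- Fix n ≥ 1, k ≥ 1, a real normed space Θ, batch sizes b, b₂ ≥ 1, and for each i ∈ Fin n maps u_i, v_i : Θ → ℝ^k differentiable at θ₀ ∈ Θ; let Σ(θ) = (1/n) ∑_i u_i(θ) v_i(θ)ᵀ and Σ̂_B(θ) the minibatch matrix of a batch B. Then for every entry (i,j), the uniform average over all pairs of batches (B₁ : Fin b → Fin n, B₂ : Fin b₂ → Fin n) of (fderiv ℝ (fun θ => Σ̂_{B₁}(θ)_{ij}) θ₀) · Σ̂_{B₂}(θ₀)_{ij} equals (fderiv ℝ (fun θ => Σ(θ)_{ij}) θ₀) · Σ(θ₀)_{ij}; i.e., because the two batches are drawn independently, the expectation of the product factorizes into the product of expectations. -/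
/-- The uniform average, over all batches of size `b`, of the batch mean of `f` is the full mean. -/
theorem average_batch_mean {M : Type*} [AddCommGroup M] [Module ℝ M] {n b : ℕ}
    (hn : 1 ≤ n) (hb : 1 ≤ b) (f : Fin n → M) :
    (1 / (n : ℝ) ^ b) • ∑ B : Fin b → Fin n, (1 / (b : ℝ)) • ∑ l : Fin b, f (B l) =
      (1 / (n : ℝ)) • ∑ l : Fin n, f l := by
  have hcoord : ∀ l : Fin b,
      ∑ B : Fin b → Fin n, f (B l) = (n : ℝ) ^ (b - 1) • ∑ a : Fin n, f a := by
    intro l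
    have h := Fintype.sum_piFinset_apply f Finset.univ l
    rw [Fintype.piFinset_univ] at h
    rw [h, ← Nat.cast_pow, Nat.cast_smul_eq_nsmul]
    simp
  have hn' : (n : ℝ) ≠ 0 := by positivity
  have hb' : (b : ℝ) ≠ 0 := by positivity
  obtain ⟨c, rfl⟩ := Nat.exists_eq_add_of_le' hb
  rw [← Finset.smul_sum, Finset.sum_comm, Finset.sum_congr rfl fun l _ => hcoord l,
    Finset.sum_const, Finset.card_univ, Fintype.card_fin, ← Nat.cast_smul_eq_nsmul ℝ]
  simp only [smul_smul, Nat.add_sub_cancel]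
  congr 1
  field_simp
  ring


/-- Because the two minibatches are drawn independently, the expectation of the product
`(∂ Σ̂_{B₁}(θ)_{ij}) ⬝ Σ̂_{B₂}(θ₀)_{ij}` factorizes: for every entry `(i,j)`, its uniform
average over all pairs of batches equals `(∂ Σ(θ)_{ij}) ⬝ Σ(θ₀)_{ij}`. -/
theorem stmt_15 (n k b b₂ : ℕ) (hn : 1 ≤ n) (hk : 1 ≤ k) (hb : 1 ≤ b) (hb₂ : 1 ≤ b₂)
    {Θ : Type*} [NormedAddCommGroup Θ] [NormedSpace ℝ Θ]
    (u v : Fin n → Θ → Fin k → ℝ) (θ₀ : Θ)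
    (hu : ∀ i, DifferentiableAt ℝ (u i) θ₀)
    (hv : ∀ i, DifferentiableAt ℝ (v i) θ₀) :
    ∀ i j : Fin k,
      (1 / ((n : ℝ) ^ b * (n : ℝ) ^ b₂)) •
        ∑ B₁ : Fin b → Fin n, ∑ B₂ : Fin b₂ → Fin n,
          ((1 / (b₂ : ℝ)) * ∑ l : Fin b₂, u (B₂ l) θ₀ i * v (B₂ l) θ₀ j) •
            fderiv ℝ (fun θ : Θ =>
              (1 / (b : ℝ)) * ∑ l : Fin b, u (B₁ l) θ i * v (B₁ l) θ j) θ₀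
      = ((1 / (n : ℝ)) * ∑ l : Fin n, u l θ₀ i * v l θ₀ j) •
          fderiv ℝ (fun θ : Θ =>
            (1 / (n : ℝ)) * ∑ l : Fin n, u l θ i * v l θ j) θ₀ := by
  intro i j
  have hdiff : ∀ l, DifferentiableAt ℝ (fun θ => u l θ i * v l θ j) θ₀ := fun l =>
    (differentiableAt_pi.1 (hu l) i).mul (differentiableAt_pi.1 (hv l) j)
  have hfderiv : ∀ (m : ℕ) (c : ℝ) (B : Fin m → Fin n),
      fderiv ℝ (fun θ : Θ => c * ∑ l : Fin m, u (B l) θ i * v (B l) θ j) θ₀ =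
        c • ∑ l : Fin m, fderiv ℝ (fun θ => u (B l) θ i * v (B l) θ j) θ₀ := by
    intro m c B
    rw [fderiv_const_mul (DifferentiableAt.fun_sum fun l _ => hdiff (B l)),
      fderiv_fun_sum fun l _ => hdiff (B l)]
  have hvalue := average_batch_mean hn hb₂ fun l => u l θ₀ i * v l θ₀ j
  have hderiv := average_batch_mean hn hb fun l => fderiv ℝ (fun θ => u l θ i * v l θ j) θ₀
  simp only [smul_eq_mul] at hvalue
  simp only [hfderiv b]
  have hfull := hfderiv n (1 / n) id
  simp only [id] at hfull
  rw [hfull, ← hvalue, ← hderiv]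
  simp only [← Finset.sum_smul, ← Finset.smul_sum]
  module
end
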